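/- arXiv:1810.09960 — 7 statements merged into one kernel-verified Lean document; each statement's English description precedes it below -/
import Mathlib

section
/- For every integer n ≥ 2 there exists a continuous surjection φ from the closed unit ball D^n of Euclidean n-space onto the annulus A^n = S^{n-1} × [0,1] (where S^{n-1} is the unit sphere of Euclidean n-space) such that φ maps the open unit ball homeomorphically onto its image, and this image φ(int D^n) is an open dense subset of S^{n-1} × [0,1]. -/
section Annulus

variable {E : Type*} [NormedAddCommGroup E]

/-- The annulus with its boundary and the segment over the pole `e` removed. -/
def slitAnnulus (e : E) : Set (Metric.sphere (0 : E) 1 × Set.Icc (0 : ℝ) 1) :=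
  {p | (p.1 : E) ≠ e ∧ (p.2 : ℝ) ∈ Set.Ioo 0 1}

theorem isOpen_slitAnnulus (e : E) : IsOpen (slitAnnulus e) :=
  (isOpen_ne.preimage (by fun_prop : Continuous
    fun p : Metric.sphere (0 : E) 1 × Set.Icc (0 : ℝ) 1 ↦ (p.1 : E))).inter
    (isOpen_Ioo.preimage (by fun_prop : Continuous
      fun p : Metric.sphere (0 : E) 1 × Set.Icc (0 : ℝ) 1 ↦ (p.2 : ℝ)))

variable [InnerProductSpace ℝ E]

/-- The map wrapping the closed unit disc of the hyperplane `eᗮ` around the unit sphere,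
collapsing the boundary of the disc to the pole `e`. -/
noncomputable def wrapSphere (e z : E) : E :=
  (2 * √(1 - ‖z‖ ^ 2)) • z + (2 * ‖z‖ ^ 2 - 1) • e

theorem continuous_wrapSphere (e : E) : Continuous (wrapSphere e) := by
  unfold wrapSphere
  fun_prop

theorem inner_wrapSphere {e z : E} (he : ‖e‖ = 1) (hz : inner ℝ e z = 0) :
    inner ℝ e (wrapSphere e z) = 2 * ‖z‖ ^ 2 - 1 := by
  simp [wrapSphere, inner_add_right, inner_smul_right, hz, he]

theorem norm_wrapSphere {e z : E} (he : ‖e‖ = 1) (hz : inner ℝ e z = 0) (h : ‖z‖ ≤ 1) :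
    ‖wrapSphere e z‖ = 1 := by
  have h0 : 0 ≤ 1 - ‖z‖ ^ 2 := by nlinarith [norm_nonneg z]
  have hs := Real.sq_sqrt h0
  have hz' : inner ℝ z e = 0 := by rw [real_inner_comm, hz]
  have : ‖wrapSphere e z‖ ^ 2 = 1 := by
    rw [wrapSphere, norm_add_sq_real, norm_smul, norm_smul, inner_smul_left, inner_smul_right,
      hz', he, mul_pow, mul_pow, Real.norm_eq_abs, Real.norm_eq_abs, sq_abs, sq_abs, mul_pow, hs]
    simp only [mul_zero]
    ring
  exact (sq_eq_sq₀ (norm_nonneg _) zero_le_one).1 (by rw [this, one_pow])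

theorem wrapSphere_eq_pole_iff {e z : E} (he : ‖e‖ = 1) (hz : inner ℝ e z = 0) :
    wrapSphere e z = e ↔ ‖z‖ = 1 := by
  constructor
  · intro h
    have h1 := inner_wrapSphere he hz
    rw [h, real_inner_self_eq_norm_sq, he] at h1
    exact (sq_eq_sq₀ (norm_nonneg _) zero_le_one).1 (by linarith)
  · intro h
    norm_num [wrapSphere, h]

theorem eq_of_wrapSphere_eq {e z z' : E} (he : ‖e‖ = 1) (hz : inner ℝ e z = 0)
    (hz' : inner ℝ e z' = 0) (h : ‖z‖ < 1) (heq : wrapSphere e z = wrapSphere e z') :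
    z = z' := by
  have hn : ‖z'‖ ^ 2 = ‖z‖ ^ 2 := by
    have h1 := inner_wrapSphere he hz
    rw [heq, inner_wrapSphere he hz'] at h1
    linarith
  have hpos : 0 < √(1 - ‖z‖ ^ 2) := Real.sqrt_pos.2 (by nlinarith [norm_nonneg z])
  rw [wrapSphere, wrapSphere, hn, add_left_inj] at heq
  exact smul_right_injective E (by positivity : (2 * √(1 - ‖z‖ ^ 2)) ≠ 0) heq

theorem exists_wrapSphere_eq {e f w : E} (he : ‖e‖ = 1) (hf : ‖f‖ = 1)
    (hef : inner ℝ e f = 0) (hw : ‖w‖ = 1) :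
    ∃ z, inner ℝ e z = 0 ∧ ‖z‖ ≤ 1 ∧ wrapSphere e z = w := by
  by_cases hwe : w = e
  · exact ⟨f, hef, hf.le, hwe ▸ (wrapSphere_eq_pole_iff he hef).2 hf⟩
  set a : ℝ := inner ℝ e w with ha
  have ha1 : a < 1 := (inner_lt_one_iff_real_of_norm_eq_one he hw).2 (Ne.symm hwe)
  have ha2 : -1 ≤ a := by
    have := neg_le_of_abs_le (abs_real_inner_le_norm e w)
    simpa [he, hw] using this
  set c : ℝ := 2 * √((1 - a) / 2) with hc
  have hcpos : 0 < c := by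
    have : 0 < √((1 - a) / 2) := Real.sqrt_pos.2 (by linarith)
    positivity
  have hc2 : c ^ 2 = 2 * (1 - a) := by
    rw [hc, mul_pow, Real.sq_sqrt (by linarith)]
    ring
  have hwa : ‖w - a • e‖ ^ 2 = (1 - a) * (1 + a) := by
    rw [norm_sub_sq_real, inner_smul_right, real_inner_comm, ← ha, norm_smul, he, hw,
      Real.norm_eq_abs, mul_one, sq_abs]
    ring
  have hz2 : ‖c⁻¹ • (w - a • e)‖ ^ 2 = (1 + a) / 2 := by
    rw [norm_smul, mul_pow, hwa, Real.norm_eq_abs, sq_abs, inv_pow, hc2]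
    have : 1 - a ≠ 0 := by linarith
    field_simp
  refine ⟨c⁻¹ • (w - a • e), ?_, ?_, ?_⟩
  · simp [inner_smul_right, inner_sub_right, he, ← ha]
  · nlinarith [norm_nonneg (c⁻¹ • (w - a • e))]
  · have h1 : 1 - (1 + a) / 2 = (1 - a) / 2 := by ring
    have h2 : 2 * ((1 + a) / 2) - 1 = a := by ring
    rw [wrapSphere, hz2, h1, h2, ← hc, smul_inv_smul₀ hcpos.ne', sub_add_cancel]

/-- The component of `x` orthogonal to the unit vector `e`. -/
noncomputable def orthComponent (e x : E) : E := x - inner ℝ e x • e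

theorem continuous_orthComponent (e : E) : Continuous (orthComponent e) := by
  unfold orthComponent
  fun_prop

theorem inner_orthComponent {e : E} (he : ‖e‖ = 1) (x : E) :
    inner ℝ e (orthComponent e x) = 0 := by
  simp [orthComponent, inner_sub_right, inner_smul_right, he]

theorem orthComponent_add_smul {e z : E} (he : ‖e‖ = 1) (hz : inner ℝ e z = 0) (t : ℝ) :
    orthComponent e (z + t • e) = z := by
  simp [orthComponent, inner_add_right, inner_smul_right, he, hz]

theorem orthComponent_smul (e x : E) (t : ℝ) :
    orthComponent e (t • x) = t • orthComponent e x := by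
  simp [orthComponent, inner_smul_right, smul_sub, smul_smul]

theorem orthComponent_add (e x y : E) :
    orthComponent e (x + y) = orthComponent e x + orthComponent e y := by
  simp only [orthComponent, inner_add_right, add_smul]
  abel

theorem continuous_abs_inner (e : E) : Continuous fun x : E ↦ |inner ℝ e x| :=
  (continuous_const.inner continuous_id).abs

/-- The solid closed cylinder of radius `1` and height `2` with axis `e`. -/
def solidCylinder (e : E) : Set E := {x | ‖orthComponent e x‖ ≤ 1 ∧ |inner ℝ e x| ≤ 1}

theorem convex_solidCylinder (e : E) : Convex ℝ (solidCylinder e) := by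
  rintro x ⟨hx, hx'⟩ y ⟨hy, hy'⟩ a b ha hb hab
  constructor
  · have := convex_closedBall (0 : E) 1 (mem_closedBall_zero_iff.2 hx)
      (mem_closedBall_zero_iff.2 hy) ha hb hab
    simpa [orthComponent_add, orthComponent_smul] using this
  · have := convex_closedBall (0 : ℝ) 1 (mem_closedBall_zero_iff.2 hx')
      (mem_closedBall_zero_iff.2 hy') ha hb hab
    simpa [inner_add_right, inner_smul_right] using this

theorem isClosed_solidCylinder (e : E) : IsClosed (solidCylinder e) :=
  (isClosed_le (continuous_orthComponent e).norm continuous_const).inter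
    (isClosed_le (continuous_abs_inner e) continuous_const)

theorem isBounded_solidCylinder {e : E} (he : ‖e‖ = 1) :
    Bornology.IsBounded (solidCylinder e) := by
  refine isBounded_iff_forall_norm_le.2 ⟨2, fun x ⟨hx, hx'⟩ ↦ ?_⟩
  calc ‖x‖ = ‖orthComponent e x + inner ℝ e x • e‖ := by simp [orthComponent]
    _ ≤ ‖orthComponent e x‖ + |inner ℝ e x| := by
      simpa [norm_smul, he] using norm_add_le (orthComponent e x) (inner ℝ e x • e)
    _ ≤ 2 := by linarith

theorem interior_solidCylinder (e : E) :
    interior (solidCylinder e) = {x | ‖orthComponent e x‖ < 1 ∧ |inner ℝ e x| < 1} := by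
  refine Set.Subset.antisymm (fun x hx ↦ ?_) (interior_maximal (fun x hx ↦ ⟨hx.1.le, hx.2.le⟩) ?_)
  · have hmem : ∀ᶠ t : ℝ in nhds 1, t • x ∈ solidCylinder e := by
      have hc : Continuous fun t : ℝ ↦ t • x := by fun_prop
      exact hc.continuousAt.eventually (by simpa using mem_interior_iff_mem_nhds.1 hx)
    obtain ⟨t, ⟨h1, h2⟩, ht⟩ :=
      ((hmem.filter_mono nhdsWithin_le_nhds).and
        (self_mem_nhdsWithin : Set.Ioi (1 : ℝ) ∈ nhdsWithin 1 (Set.Ioi 1))).exists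
    replace ht : 1 < t := ht
    have ht0 : 0 < t := by linarith
    rw [orthComponent_smul, norm_smul, Real.norm_of_nonneg ht0.le] at h1
    rw [inner_smul_right, abs_mul, abs_of_pos ht0] at h2
    exact ⟨by nlinarith [norm_nonneg (orthComponent e x)],
      by nlinarith [abs_nonneg (inner ℝ e x)]⟩
  · exact (isOpen_lt (continuous_orthComponent e).norm continuous_const).inter
      (isOpen_lt (continuous_abs_inner e) continuous_const)

/-- The quotient map from the solid cylinder onto the annulus. -/
noncomputable def cylinderToAnnulus {e : E} (he : ‖e‖ = 1) (x : solidCylinder e) :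
    Metric.sphere (0 : E) 1 × Set.Icc (0 : ℝ) 1 :=
  (⟨wrapSphere e (orthComponent e x),
      mem_sphere_zero_iff_norm.2 (norm_wrapSphere he (inner_orthComponent he _) x.2.1)⟩,
    ⟨(1 + inner ℝ e (x : E)) / 2, by
      have := abs_le.1 x.2.2
      constructor <;> linarith⟩)

theorem continuous_cylinderToAnnulus {e : E} (he : ‖e‖ = 1) :
    Continuous (cylinderToAnnulus he) :=
  (((continuous_wrapSphere e).comp
    ((continuous_orthComponent e).comp continuous_subtype_val)).subtype_mk _).prodMk
    (Continuous.subtype_mk (by fun_prop) _)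

theorem surjective_cylinderToAnnulus {e f : E} (he : ‖e‖ = 1) (hf : ‖f‖ = 1)
    (hef : inner ℝ e f = 0) : Function.Surjective (cylinderToAnnulus he) := by
  rintro ⟨⟨w, hw⟩, ⟨s, hs0, hs1⟩⟩
  obtain ⟨z, hz, hz1, rfl⟩ := exists_wrapSphere_eq he hf hef (mem_sphere_zero_iff_norm.1 hw)
  have hi : inner ℝ e (z + (2 * s - 1) • e) = 2 * s - 1 := by
    simp [inner_add_right, inner_smul_right, hz, he]
  refine ⟨⟨z + (2 * s - 1) • e, ?_, ?_⟩, ?_⟩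
  · rwa [orthComponent_add_smul he hz]
  · rw [hi, abs_le]
    constructor <;> linarith
  · refine Prod.ext (Subtype.ext ?_) (Subtype.ext ?_)
    · simp only [cylinderToAnnulus, orthComponent_add_smul he hz]
    · simp only [cylinderToAnnulus, hi]
      ring

theorem cylinderToAnnulus_mem_slitAnnulus_iff {e : E} (he : ‖e‖ = 1) (x : solidCylinder e) :
    cylinderToAnnulus he x ∈ slitAnnulus e ↔ (x : E) ∈ interior (solidCylinder e) := by
  have h1 := wrapSphere_eq_pole_iff he (inner_orthComponent he (x : E))
  have h2 := x.2.1
  rw [interior_solidCylinder]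
  simp only [slitAnnulus, cylinderToAnnulus, Set.mem_ofPred_eq, Set.mem_Ioo, ne_eq, h1, abs_lt]
  refine and_congr (h2.lt_iff_ne.symm) ⟨fun h ↦ ?_, fun h ↦ ?_⟩ <;>
    constructor <;> linarith [h.1, h.2]

theorem eq_of_cylinderToAnnulus_eq {e : E} (he : ‖e‖ = 1) {x y : solidCylinder e}
    (hx : (x : E) ∈ interior (solidCylinder e))
    (h : cylinderToAnnulus he x = cylinderToAnnulus he y) : x = y := by
  rw [interior_solidCylinder] at hx
  have h1 : wrapSphere e (orthComponent e (x : E)) = wrapSphere e (orthComponent e (y : E)) :=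
    congrArg (fun p ↦ (p.1 : E)) h
  have h2 : (1 + inner ℝ e (x : E)) / 2 = (1 + inner ℝ e (y : E)) / 2 :=
    congrArg (fun p ↦ (p.2 : ℝ)) h
  have h3 := eq_of_wrapSphere_eq he (inner_orthComponent he _) (inner_orthComponent he _) hx.1 h1
  have h4 : inner ℝ e (x : E) = inner ℝ e (y : E) := by linarith
  apply Subtype.ext
  rw [orthComponent, orthComponent, h4] at h3
  exact sub_left_injective h3

end Annulus

/-- A closed continuous map which is injective on the preimage of an open set `U` restricts to an
open embedding on that preimage. -/
theorem IsClosedMap.isOpenEmbedding_comp_of_range_eq_preimage {X Y Z : Type*} [TopologicalSpace X]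
    [TopologicalSpace Y] [TopologicalSpace Z] {f : X → Y} (hf : IsClosedMap f) (hc : Continuous f)
    {U : Set Y} (hU : IsOpen U) {i : Z → X} (hi : Topology.IsEmbedding i)
    (hrange : Set.range i = f ⁻¹' U) (hinj : Set.InjOn f (f ⁻¹' U)) (hsurj : U ⊆ Set.range f) :
    Topology.IsOpenEmbedding (f ∘ i) := by
  have hr : Topology.IsClosedEmbedding (U.restrictPreimage f) :=
    .of_continuous_injective_isClosedMap hc.restrictPreimage
      (fun a b h ↦ Subtype.ext (hinj a.2 b.2 (congrArg Subtype.val h))) (hf.restrictPreimage U)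
  have hfi : Topology.IsEmbedding (f ∘ i) := by
    have := Topology.IsEmbedding.subtypeVal.comp (hr.isEmbedding.comp
      (hi.codRestrict (f ⁻¹' U) fun z ↦ hrange ▸ Set.mem_range_self z))
    exact this
  refine ⟨hfi, ?_⟩
  rwa [Set.range_comp, hrange, Set.image_preimage_eq_of_subset hsurj]

/-- For every `n ≥ 2` there is a continuous surjection `φ` from the closed
unit ball `D^n` of Euclidean `n`-space onto the annulus `A^n = S^{n-1} × [0,1]` such that
`φ` maps the open unit ball homeomorphically onto its image, this image being an open dense
subset of `S^{n-1} × [0,1]`. -/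
theorem exists_map_disc_onto_annulus (n : ℕ) (hn : 2 ≤ n) :
    ∃ φ : (Metric.closedBall (0 : EuclideanSpace ℝ (Fin n)) 1) →
        (Metric.sphere (0 : EuclideanSpace ℝ (Fin n)) 1) × (Set.Icc (0 : ℝ) 1),
      Continuous φ ∧ Function.Surjective φ ∧
      (letI ψ : (Metric.ball (0 : EuclideanSpace ℝ (Fin n)) 1) →
          (Metric.sphere (0 : EuclideanSpace ℝ (Fin n)) 1) × (Set.Icc (0 : ℝ) 1) :=
        fun x => φ ⟨(x : EuclideanSpace ℝ (Fin n)), Metric.ball_subset_closedBall x.2⟩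
      Topology.IsOpenEmbedding ψ ∧ Dense (Set.range ψ)) := by
  obtain ⟨e, f, he, hf, hef⟩ : ∃ e f : EuclideanSpace ℝ (Fin n),
      ‖e‖ = 1 ∧ ‖f‖ = 1 ∧ inner ℝ e f = 0 :=
    ⟨EuclideanSpace.single ⟨0, by omega⟩ 1, EuclideanSpace.single ⟨1, by omega⟩ 1,
      by simp, by simp, by simp [EuclideanSpace.inner_single_left]⟩
  obtain ⟨h, hint, hcl, -⟩ := exists_homeomorph_image_interior_closure_frontier_eq_unitBall
    (convex_solidCylinder e)
    ⟨0, by rw [interior_solidCylinder]; simp [orthComponent]⟩ (isBounded_solidCylinder he)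
  rw [(isClosed_solidCylinder e).closure_eq] at hcl
  have hmem (x) : h x ∈ Metric.closedBall 0 1 ↔ x ∈ solidCylinder e := by
    rw [← hcl, h.injective.mem_set_image]
  have hmem_int (x) : h x ∈ Metric.ball 0 1 ↔ x ∈ interior (solidCylinder e) := by
    rw [← hint, h.injective.mem_set_image]
  let g : Metric.closedBall (0 : EuclideanSpace ℝ (Fin n)) 1 ≃ₜ solidCylinder e :=
    (h.subtype fun x ↦ (hmem x).symm).symm
  have hg (x) : (g x : EuclideanSpace ℝ (Fin n)) ∈ interior (solidCylinder e) ↔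
      (x : EuclideanSpace ℝ (Fin n)) ∈ Metric.ball 0 1 := by
    rw [← hmem_int]
    exact iff_of_eq (congrArg (· ∈ Metric.ball 0 1) (h.apply_symm_apply (x : _)))
  have hcont : Continuous (cylinderToAnnulus he ∘ g) :=
    (continuous_cylinderToAnnulus he).comp g.continuous
  have hsurj : Function.Surjective (cylinderToAnnulus he ∘ g) :=
    (surjective_cylinderToAnnulus he hf hef).comp g.surjective
  have hdense : DenseRange (Set.inclusion
      (Metric.ball_subset_closedBall (x := (0 : EuclideanSpace ℝ (Fin n))) (ε := 1))) := by
    rw [denseRange_inclusion_iff, closure_ball _ one_ne_zero]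
  have hpre : (cylinderToAnnulus he ∘ g) ⁻¹' slitAnnulus e =
      {x : Metric.closedBall (0 : EuclideanSpace ℝ (Fin n)) 1 |
        (x : EuclideanSpace ℝ (Fin n)) ∈ Metric.ball 0 1} := by
    ext x
    rw [Set.mem_preimage, Function.comp_apply, cylinderToAnnulus_mem_slitAnnulus_iff, hg]
    rfl
  refine ⟨cylinderToAnnulus he ∘ g, hcont, hsurj, ?_, hsurj.denseRange.comp hdense hcont⟩
  refine hcont.isClosedMap.isOpenEmbedding_comp_of_range_eq_preimage hcont (isOpen_slitAnnulus e)
    (Topology.IsEmbedding.inclusion Metric.ball_subset_closedBall) ?_ ?_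
    (hsurj.range_eq ▸ Set.subset_univ _)
  · exact (Set.range_inclusion Metric.ball_subset_closedBall).trans hpre.symm
  · rw [hpre]
    exact fun x hx y _ hxy ↦ g.injective (eq_of_cylinderToAnnulus_eq he ((hg x).2 hx) hxy)
end

section
/- For every integer n ≥ 2 there exists a continuous map g : D^n → ℝ² from the closed unit ball of Euclidean n-space into the plane such that g maps the boundary sphere S^{n-1} to the single point 0 ∈ ℝ², and the set of single points of g is dense in D^n. -/
open Metric Set

/-- The condition that all points of the fibre of `f` through `x` are `ε`-close to `x` is open
in `f`. -/
lemma ContinuousMap.isOpen_setOf_fiber_subset_ball {X F : Type*} [MetricSpace X] [CompactSpace X]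
    [NormedAddCommGroup F] (x : X) (ε : ℝ) :
    IsOpen {f : C(X, F) | ∀ y, f y = f x → dist y x < ε} := by
  have hK : IsCompact {y : X | ε ≤ dist y x} :=
    (isClosed_le continuous_const (by fun_prop)).isCompact
  have hU : IsOpen ({0}ᶜ : Set F) := isOpen_compl_singleton
  have hc : Continuous fun f : C(X, F) => f - ContinuousMap.const X (f x) :=
    continuous_id.sub (ContinuousMap.continuous_const'.comp (continuous_eval_const x))
  convert (ContinuousMap.isOpen_setOfPred_mapsTo hK hU).preimage hc using 1
  ext f
  simp only [mem_ofPred_eq, mem_preimage, MapsTo, mem_compl_iff, mem_singleton_iff,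
    ContinuousMap.sub_apply, ContinuousMap.const_apply, sub_eq_zero]
  exact forall_congr' fun y => ⟨fun h hy he => (h he).not_ge hy, fun h he => by
    by_contra hy
    exact h (not_lt.mp hy) he⟩

section Whisker

variable {E F : Type*} [NormedAddCommGroup E] [NormedSpace ℝ E]
  [NormedAddCommGroup F] [NormedSpace ℝ F]

/-- A self-map of the closed unit ball, supported in `closedBall x (2 * r)`, which collapses
`closedBall x r` to `x`. -/
lemma exists_collapse_closedBall (x : closedBall (0 : E) 1) {r : ℝ} (hr : 0 < r) :
    ∃ σ : C(closedBall (0 : E) 1, closedBall (0 : E) 1),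
      (∀ y, dist y x ≤ r → σ y = x) ∧ (∀ y, 2 * r ≤ dist y x → σ y = y) ∧
      ∀ y, dist (σ y) y ≤ 2 * r := by
  let c : closedBall (0 : E) 1 → ℝ := fun y => max 0 (min 1 (2 - dist y x / r))
  have hc : Continuous c := by fun_prop
  have hc0 : ∀ y, 0 ≤ c y := fun y => le_max_left _ _
  have hc1 : ∀ y, c y ≤ 1 := fun y => max_le zero_le_one (min_le_left _ _)
  have hmem : ∀ y : closedBall (0 : E) 1, AffineMap.lineMap (y : E) (x : E) (c y) ∈ closedBall (0 : E) 1 := fun y =>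
    (convex_closedBall (0 : E) 1).lineMap_mem y.2 x.2 ⟨hc0 y, hc1 y⟩
  have hcfar : ∀ y, 2 * r ≤ dist y x → c y = 0 := fun y hy => by
    have : 2 ≤ dist y x / r := by rwa [le_div_iff₀ hr]
    exact max_eq_left ((min_le_right _ _).trans (by linarith))
  have hfar : ∀ y, 2 * r ≤ dist y x →
      (⟨AffineMap.lineMap (y : E) (x : E) (c y), hmem y⟩ : closedBall (0 : E) 1) = y :=
    fun y hy => Subtype.ext (by simp [hcfar y hy])
  refine ⟨⟨fun y => ⟨AffineMap.lineMap (y : E) (x : E) (c y), hmem y⟩, ?_⟩, ?_, hfar, ?_⟩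
  · refine Continuous.subtype_mk ?_ _
    simp only [AffineMap.lineMap_apply_module]
    fun_prop
  · intro y hy
    have h1 : dist y x / r ≤ 1 := by rwa [div_le_one hr]
    have : c y = 1 := by
      simp only [c]
      rw [min_eq_left (by linarith), max_eq_right zero_le_one]
    exact Subtype.ext (by simp [this])
  · intro y
    rcases le_total (2 * r) (dist y x) with hy | hy
    · change dist (⟨AffineMap.lineMap (y : E) (x : E) (c y), hmem y⟩ : closedBall (0 : E) 1) y ≤ _
      rw [hfar y hy, dist_self]
      positivity
    · change dist (AffineMap.lineMap (y : E) (x : E) (c y)) (y : E) ≤ _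
      rw [dist_lineMap_left, Real.norm_of_nonneg (hc0 y)]
      exact (mul_le_of_le_one_left dist_nonneg (hc1 y)).trans hy

/-- The maps from the closed unit ball which vanish on the unit sphere and have image of Hausdorff
dimension at most one. -/
def thinMaps (E F : Type*) [NormedAddCommGroup E] [NormedAddCommGroup F] :
    Set C(closedBall (0 : E) 1, F) :=
  {f | (∀ x : closedBall (0 : E) 1, (x : E) ∈ sphere (0 : E) 1 → f x = 0) ∧ dimH (range f) ≤ 1}

/-- Any interior point can be made a single point of a thin map by growing a small whisker there. -/
lemma exists_thinMaps_near_single [FiniteDimensional ℝ E] [FiniteDimensional ℝ F]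
    (hF : 2 ≤ Module.finrank ℝ F)
    {f : C(closedBall (0 : E) 1, F)} (hf : f ∈ thinMaps E F) {x : closedBall (0 : E) 1}
    (hx : ‖(x : E)‖ < 1) {ε : ℝ} (hε : 0 < ε) :
    ∃ g ∈ thinMaps E F, dist g f < ε ∧ ∀ y, g y = g x → y = x := by
  have hdense : Dense (range f)ᶜ := dense_compl_of_dimH_lt_finrank
    (hf.2.trans_lt (by exact_mod_cast hF))
  obtain ⟨q, hqK, hq⟩ := hdense.exists_dist_lt (f x) (show 0 < ε / 4 by positivity)
  have hqx : q - f x ≠ 0 := fun h => hqK ⟨x, (sub_eq_zero.mp h).symm⟩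
  obtain ⟨δ, hδ, hfδ⟩ := Metric.uniformContinuous_iff.mp
    (CompactSpace.uniformContinuous_of_continuous f.continuous) (ε / 4) (by positivity)
  obtain ⟨r, hr, hrδ, hrx⟩ : ∃ r : ℝ, 0 < r ∧ 2 * r < δ ∧ 2 * r ≤ 1 - ‖(x : E)‖ :=
    ⟨min (δ / 4) ((1 - ‖(x : E)‖) / 2), lt_min (by positivity) (by linarith),
      by linarith [min_le_left (δ / 4) ((1 - ‖(x : E)‖) / 2)],
      by linarith [min_le_right (δ / 4) ((1 - ‖(x : E)‖) / 2)]⟩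
  obtain ⟨σ, hσn, hσf, hσd⟩ := exists_collapse_closedBall x hr
  let φ : C(closedBall (0 : E) 1, ℝ) := ⟨fun y => max 0 (1 - dist y x / r), by fun_prop⟩
  have hφ0 : ∀ y, 0 ≤ φ y := fun y => le_max_left _ _
  have hφ1 : ∀ y, φ y ≤ 1 := fun y =>
    max_le zero_le_one (by linarith [div_nonneg (dist_nonneg (x := y) (y := x)) hr.le])
  have hφfar : ∀ y, r ≤ dist y x → φ y = 0 := fun y hy => by
    have : 1 ≤ dist y x / r := by rwa [one_le_div hr]
    exact max_eq_left (by linarith)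
  have hφeq : ∀ y, φ y = 1 → y = x := fun y hy => by
    have h : max 0 (1 - dist y x / r) = 1 := hy
    have h' : dist y x / r = 0 := by
      rcases max_choice 0 (1 - dist y x / r) with h0 | h0 <;> linarith
    rcases div_eq_zero_iff.mp h' with h0 | h0
    · exact dist_eq_zero.mp h0
    · exact absurd h0 hr.ne'
  have hφx : φ x = 1 := by simp [φ]
  let g : C(closedBall (0 : E) 1, F) := ⟨fun y => f (σ y) + φ y • (q - f x), by fun_prop⟩
  have hg : ∀ y, g y = f (σ y) + φ y • (q - f x) := fun _ => rfl
  have hgnear : ∀ y, dist y x ≤ r → g y = f x + φ y • (q - f x) := fun y hy => by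
    rw [hg, hσn y hy]
  have hgfar : ∀ y, r ≤ dist y x → g y = f (σ y) := fun y hy => by
    rw [hg, hφfar y hy, zero_smul, add_zero]
  have hgx : g x = q := by
    rw [hgnear x (by simpa using hr.le), hφx, one_smul, add_sub_cancel]
  refine ⟨g, ⟨fun y hy => ?_, ?_⟩, ?_, fun y hy => ?_⟩
  · have hd : 2 * r ≤ dist y x := by
      have h1 : ‖(y : E)‖ - ‖(x : E)‖ ≤ ‖(y : E) - x‖ := norm_sub_norm_le _ _
      rw [mem_sphere_zero_iff_norm.mp hy, ← dist_eq_norm] at h1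
      exact hrx.trans h1
    rw [hgfar y (by linarith), hσf y hd, hf.1 y hy]
  · have hsub : range g ⊆ range f ∪ range fun t : ℝ => f x + t • (q - f x) := by
      rintro _ ⟨y, rfl⟩
      rcases le_total r (dist y x) with hy | hy
      · exact Or.inl ⟨σ y, (hgfar y hy).symm⟩
      · exact Or.inr ⟨φ y, (hgnear y hy).symm⟩
    have hline : dimH (range fun t : ℝ => f x + t • (q - f x)) ≤ 1 := by
      have hs : ContDiff ℝ 1 fun t : ℝ => f x + t • (q - f x) := by fun_prop
      simpa using hs.dimH_range_le
    exact (dimH_mono hsub).trans (by rw [dimH_union]; exact max_le hf.2 hline)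
  · refine lt_of_le_of_lt ((ContinuousMap.dist_le (by positivity)).mpr fun y => ?_)
      (show ε / 2 < ε by linarith)
    have h1 : dist (f (σ y)) (f y) < ε / 4 := hfδ ((hσd y).trans_lt hrδ)
    have h2 : ‖φ y • (q - f x)‖ ≤ ε / 4 := by
      rw [norm_smul, Real.norm_of_nonneg (hφ0 y), ← dist_eq_norm, dist_comm]
      exact (mul_le_of_le_one_left dist_nonneg (hφ1 y)).trans hq.le
    have h3 : dist (g y) (f (σ y)) = ‖φ y • (q - f x)‖ := by
      rw [hg, dist_eq_norm, add_sub_cancel_left]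
    linarith [dist_triangle (g y) (f (σ y)) (f y)]
  · rw [hgx] at hy
    rcases le_total r (dist y x) with hd | hd
    · exact absurd ⟨σ y, (hgfar y hd).symm.trans hy⟩ hqK
    · rw [hgnear y hd] at hy
      have h : (1 - φ y) • (q - f x) = 0 := by
        rw [sub_smul, one_smul, sub_eq_zero, sub_eq_iff_eq_add', hy]
      exact hφeq y (by linarith [(smul_eq_zero.mp h).resolve_right hqx])

/-- By Baire category, the closure of the thin maps contains a map for which every point of a given
countable subset of the open ball is a single point. -/
lemma exists_mem_closure_thinMaps_single [FiniteDimensional ℝ E] [FiniteDimensional ℝ F]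
    (hF : 2 ≤ Module.finrank ℝ F) {t : Set (closedBall (0 : E) 1)} (ht : t.Countable)
    (ht1 : ∀ x ∈ t, ‖(x : E)‖ < 1) :
    ∃ g ∈ closure (thinMaps E F), ∀ x ∈ t, ∀ y, g y = g x → y = x := by
  have : Countable t := ht
  have : CompleteSpace (closure (thinMaps E F)) := isClosed_closure.completeSpace_coe
  have h0 : (0 : C(closedBall (0 : E) 1, F)) ∈ thinMaps E F :=
    ⟨fun _ _ => rfl, by
      rw [dimH_subsingleton]
      · exact zero_le
      · rintro _ ⟨_, rfl⟩ _ ⟨_, rfl⟩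
        rfl⟩
  have : Nonempty (closure (thinMaps E F)) := ⟨⟨0, subset_closure h0⟩⟩
  let O : t × ℕ → Set (closure (thinMaps E F)) := fun i =>
    Subtype.val ⁻¹' {g | ∀ y, g y = g i.1 → dist y i.1 < 1 / (i.2 + 1 : ℝ)}
  have hO : ∀ i, IsOpen (O i) := fun i =>
    (ContinuousMap.isOpen_setOf_fiber_subset_ball _ _).preimage continuous_subtype_val
  have hd : ∀ i, Dense (O i) := fun i => by
    refine Metric.dense_iff.mpr fun g ε hε => ?_
    obtain ⟨f, hf, hgf⟩ := Metric.mem_closure_iff.mp g.2 (ε / 2) (by positivity)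
    obtain ⟨g', hg', hd', hs⟩ :=
      exists_thinMaps_near_single hF hf (ht1 i.1 i.1.2) (show 0 < ε / 2 by positivity)
    refine ⟨⟨g', subset_closure hg'⟩, ?_, fun y hy => ?_⟩
    · change dist g' (g : C(closedBall (0 : E) 1, F)) < ε
      rw [dist_comm] at hgf
      linarith [dist_triangle g' f (g : C(closedBall (0 : E) 1, F))]
    · rw [hs y hy, dist_self]
      positivity
  obtain ⟨g, hg⟩ := (dense_iInter_of_isOpen hO hd).nonempty
  refine ⟨g, g.2, fun x hx y hy => dist_le_zero.mp (le_of_forall_pos_lt_add fun ε hε => ?_)⟩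
  obtain ⟨k, hk⟩ := exists_nat_one_div_lt hε
  rw [zero_add]
  exact (mem_iInter.mp hg (⟨x, hx⟩, k) y hy).trans hk

/-- The open unit ball is dense in the closed unit ball. -/
lemma dense_setOf_norm_lt_one : Dense {x : closedBall (0 : E) 1 | ‖(x : E)‖ < 1} := by
  rw [Subtype.dense_iff]
  have h : ((↑) : closedBall (0 : E) 1 → E) '' {x | ‖(x : E)‖ < 1} = ball 0 1 := by
    ext x
    simp only [mem_image, mem_ofPred_eq, Subtype.exists, mem_closedBall_zero_iff,
      mem_ball_zero_iff, exists_and_right, exists_eq_right]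
    exact ⟨fun h => by tauto, fun h => by simp [h, h.le]⟩
  rw [h, closure_ball _ one_ne_zero]

end Whisker


/-- For every `n ≥ 2` there is a continuous map `g : D^n → ℝ²` sending the
boundary sphere `S^{n-1}` to `0` and whose set of single points is dense in `D^n`. -/
theorem exists_map_disc_to_plane_boundary_zero_dense_single_points (n : ℕ) (hn : 2 ≤ n) :
    ∃ g : (Metric.closedBall (0 : EuclideanSpace ℝ (Fin n)) 1) → EuclideanSpace ℝ (Fin 2),
      Continuous g ∧
      (∀ x : Metric.closedBall (0 : EuclideanSpace ℝ (Fin n)) 1,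
        (x : EuclideanSpace ℝ (Fin n)) ∈ Metric.sphere (0 : EuclideanSpace ℝ (Fin n)) 1 →
          g x = 0) ∧
      Dense {x : Metric.closedBall (0 : EuclideanSpace ℝ (Fin n)) 1 | g ⁻¹' {g x} = {x}} := by
  obtain ⟨t, hts, htc, htd⟩ := (dense_setOf_norm_lt_one
    (E := EuclideanSpace ℝ (Fin n))).exists_countable_dense_subset
  obtain ⟨g, hg, hsingle⟩ := exists_mem_closure_thinMaps_single
    (F := EuclideanSpace ℝ (Fin 2)) (by simp) htc hts
  refine ⟨g, g.continuous, fun x hx => ?_, htd.mono fun x hx => ?_⟩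
  · have hclosed : IsClosed {f : C(closedBall (0 : EuclideanSpace ℝ (Fin n)) 1,
        EuclideanSpace ℝ (Fin 2)) | f x = 0} :=
      isClosed_eq (continuous_eval_const x) continuous_const
    exact closure_minimal (fun f hf => hf.1 x hx) hclosed hg
  · exact Subset.antisymm (hsingle x hx) (singleton_subset_iff.mpr rfl)
end

section
/- For every integer n ≥ 2 there exists a continuous map f : S^n → ℝ² from the n-sphere into the plane such that the set of single points of f is dense in S^n. -/
open Set Metric Topology in
/-- Every ball of the plane `ℝ × ℝ` (with the sup norm) can be collapsed to its centre by a
Lipschitz map which is uniformly close to the identity. -/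
theorem exists_lipschitz_collapse (p : ℝ × ℝ) {δ : ℝ} (hδ : 0 < δ) :
    ∃ (K : NNReal) (r : ℝ × ℝ → ℝ × ℝ), LipschitzWith K r ∧ (∀ y, dist (r y) y ≤ δ) ∧
      ∀ y ∈ closedBall p δ, r y = p := by
  have hc : LipschitzWith 1 (fun t : ℝ => max (-δ) (min t δ)) :=
    (LipschitzWith.id.min_const δ).const_max (-δ)
  have h1 := hc.comp ((LipschitzWith.prod_fst (α := ℝ) (β := ℝ)).sub (LipschitzWith.const p.1))
  have h2 := hc.comp ((LipschitzWith.prod_snd (α := ℝ) (β := ℝ)).sub (LipschitzWith.const p.2))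
  refine ⟨_, _, LipschitzWith.id.sub (h1.prodMk h2), fun y => ?_, fun y hy => ?_⟩
  · have hb : ∀ t : ℝ, |max (-δ) (min t δ)| ≤ δ := fun t =>
      abs_le.2 ⟨le_max_left _ _, max_le (by linarith) (min_le_right _ _)⟩
    simp only [dist_eq_norm, Function.comp_def, id, sub_sub_cancel_left, norm_neg]
    exact norm_prod_le_iff.2 ⟨hb _, hb _⟩
  · rw [mem_closedBall, Prod.dist_eq, max_le_iff, Real.dist_eq, Real.dist_eq, abs_le, abs_le] at hy
    obtain ⟨⟨ha, hb⟩, hc, hd⟩ := hy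
    ext <;> simp [*]

open Set Metric Topology in
/-- A map whose image has dimension less than two can be approximated by such maps for which a
given point `d` is not identified with any point outside a given neighbourhood of `d`. -/
theorem exists_dist_lt_of_dimH_range_lt {X : Type*} [MetricSpace X] [CompactSpace X]
    (g : C(X, ℝ × ℝ)) (hg : dimH (range g) < 2) (d : X) {ρ ε : ℝ} (hρ : 0 < ρ) (hε : 0 < ε) :
    ∃ h : C(X, ℝ × ℝ), dimH (range h) < 2 ∧ dist h g < ε ∧
      ∀ x ∈ (ball d ρ)ᶜ, h x ≠ h d := by
  set p := g d with hp
  obtain ⟨K, r, hr, hrd, hrp⟩ := exists_lipschitz_collapse p (half_pos (half_pos hε))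
  have hrg : dimH (r '' range g) < 2 := (hr.dimH_image_le _).trans_lt hg
  have hdense : Dense (r '' range g)ᶜ := dense_compl_of_dimH_lt_finrank (by simpa using hrg)
  obtain ⟨q, hqr, hq⟩ := hdense.exists_dist_lt p (half_pos (half_pos hε))
  set V : Set X := ball d ρ ∩ g ⁻¹' ball p (ε / 2 / 2)
  have hV : IsOpen V := isOpen_ball.inter (isOpen_ball.preimage g.continuous)
  have hdV : d ∈ V := ⟨mem_ball_self hρ, by simp [← hp]; positivity⟩
  obtain ⟨φ, hφ0, hφ1, hφ⟩ := exists_continuous_zero_one_of_isClosed hV.isClosed_compl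
    (isClosed_singleton (x := d)) (by simpa using hdV)
  have hout : ∀ x ∉ V, r (g x) + φ x • (q - p) = r (g x) := fun x hx => by
    simp [hφ0 hx]
  have hin : ∀ x ∈ V, r (g x) = p := fun x hx => hrp _ (ball_subset_closedBall hx.2)
  let h : C(X, ℝ × ℝ) := ⟨fun x => r (g x) + φ x • (q - p),
    (hr.continuous.comp g.continuous).add (φ.continuous.smul continuous_const)⟩
  have hhd : h d = q := by
    change r (g d) + φ d • (q - p) = q
    rw [hin d hdV, hφ1 (mem_singleton d)]; simp
  refine ⟨h, ?_, ?_, fun x hx => ?_⟩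
  · have hl : ContDiff ℝ 1 (fun t : ℝ => p + t • (q - p)) := by fun_prop
    have hl' : dimH (range fun t : ℝ => p + t • (q - p)) < 2 :=
      hl.dimH_range_le.trans_lt (by simp)
    have hsub : range h ⊆ r '' range g ∪ range fun t : ℝ => p + t • (q - p) := by
      rintro _ ⟨x, rfl⟩
      by_cases hx : x ∈ V
      · exact Or.inr ⟨φ x, by change _ = r (g x) + _; rw [hin x hx]⟩
      · exact Or.inl ⟨g x, mem_range_self x, (hout x hx).symm⟩
    refine (dimH_mono hsub).trans_lt ?_
    rw [dimH_union]
    exact max_lt hrg hl'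
  · refine (ContinuousMap.dist_lt_iff hε).2 fun x => ?_
    have h1 : dist (h x) (r (g x)) ≤ ε / 2 / 2 := by
      change dist (r (g x) + φ x • (q - p)) _ ≤ _
      rw [dist_self_add_left, norm_smul, Real.norm_of_nonneg (hφ x).1, ← dist_eq_norm, dist_comm]
      exact (mul_le_of_le_one_left dist_nonneg (hφ x).2).trans hq.le
    linarith [dist_triangle (h x) (r (g x)) (g x), hrd (g x)]
  · rw [hhd]
    have hxV : x ∉ V := fun hxV => hx hxV.1
    change r (g x) + φ x • (q - p) ≠ q
    rw [hout x hxV]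
    exact fun hxq => hqr ⟨g x, mem_range_self x, hxq⟩

open Set Metric Topology in
/-- For compact `K`, it is an open condition on `f` that `f d` is not a value of `f` on `K`. -/
theorem isOpen_setOf_forall_apply_ne {X : Type*} [TopologicalSpace X] {K : Set X}
    (hK : IsCompact K) (d : X) : IsOpen {f : C(X, ℝ × ℝ) | ∀ x ∈ K, f x ≠ f d} := by
  have hcont : Continuous fun f : C(X, ℝ × ℝ) => f - ContinuousMap.const X (f d) :=
    continuous_id.sub (ContinuousMap.continuous_const'.comp (continuous_eval_const d))
  have := (ContinuousMap.isOpen_setOfPred_mapsTo hK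
    (isOpen_compl_singleton (x := (0 : ℝ × ℝ)))).preimage hcont
  convert this using 1
  ext f
  simp [MapsTo, sub_eq_zero]

open Set Metric Topology in
/-- Every compact metric space has a continuous map to the plane with a dense set of single
points. -/
theorem exists_map_to_plane_dense_single_points (X : Type*) [MetricSpace X] [CompactSpace X] :
    ∃ f : C(X, ℝ × ℝ), Dense {x : X | f ⁻¹' {f x} = {x}} := by
  obtain ⟨D, hDc, hD⟩ := TopologicalSpace.exists_countable_dense X
  have : Countable D := hDc.to_subtype
  let S : Set C(X, ℝ × ℝ) := {g | dimH (range g) < 2}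
  let U : D × ℕ → Set C(X, ℝ × ℝ) := fun i =>
    {f | ∀ x ∈ (ball (i.1 : X) (1 / ((i.2 : ℝ) + 1)))ᶜ, f x ≠ f i.1}
  have hU : ∀ i, IsOpen (U i) := fun i =>
    isOpen_setOf_forall_apply_ne isOpen_ball.isClosed_compl.isCompact _
  have hSU : ∀ i, S ⊆ closure (S ∩ U i) := fun i g hg => by
    refine Metric.mem_closure_iff.2 fun ε hε => ?_
    obtain ⟨h, hS, hd, hh⟩ := exists_dist_lt_of_dimH_range_lt g hg i.1
      (Nat.one_div_pos_of_nat (n := i.2)) hε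
    exact ⟨h, ⟨hS, hh⟩, by rwa [dist_comm]⟩
  have : CompleteSpace (closure S) := isClosed_closure.completeSpace_coe
  have : Nonempty (closure S) := by
    refine ⟨⟨0, subset_closure ?_⟩⟩
    have hs : (range (0 : C(X, ℝ × ℝ))).Subsingleton := by
      rintro _ ⟨x, rfl⟩ _ ⟨y, rfl⟩
      rfl
    exact (dimH_subsingleton hs).trans_lt (by norm_num)
  have hdense : Dense (⋂ i, ((↑) : closure S → C(X, ℝ × ℝ)) ⁻¹' U i) := by
    refine dense_iInter_of_isOpen (fun i => (hU i).preimage continuous_subtype_val) fun i => ?_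
    rw [Subtype.dense_iff, Subtype.image_preimage_coe]
    exact closure_minimal
      ((hSU i).trans (closure_mono (inter_subset_inter_left _ subset_closure))) isClosed_closure
  obtain ⟨⟨f, _⟩, hf⟩ := hdense.nonempty
  refine ⟨f, hD.mono fun d hd => ?_⟩
  refine eq_singleton_iff_unique_mem.2 ⟨rfl, fun x hx => ?_⟩
  by_contra hne
  obtain ⟨n, hn⟩ := exists_nat_one_div_lt (dist_pos.2 hne)
  exact mem_iInter.1 hf (⟨d, hd⟩, n) x (fun hb => (mem_ball.1 hb).not_gt hn) hx

/-- For every `n ≥ 2` there is a continuous map `f : S^n → ℝ²` whose set of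
single points is dense in `S^n`. -/
theorem exists_map_sphere_to_plane_dense_single_points (n : ℕ) (hn : 2 ≤ n) :
    ∃ f : (Metric.sphere (0 : EuclideanSpace ℝ (Fin (n + 1))) 1) → EuclideanSpace ℝ (Fin 2),
      Continuous f ∧
      Dense {x : Metric.sphere (0 : EuclideanSpace ℝ (Fin (n + 1))) 1 | f ⁻¹' {f x} = {x}} := by
  obtain ⟨f, hf⟩ := exists_map_to_plane_dense_single_points
    (Metric.sphere (0 : EuclideanSpace ℝ (Fin (n + 1))) 1)
  let e : (ℝ × ℝ) ≃L[ℝ] EuclideanSpace ℝ (Fin 2) :=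
    ContinuousLinearEquiv.ofFinrankEq (by simp)
  refine ⟨e ∘ f, e.continuous.comp f.continuous, hf.mono fun x hx => ?_⟩
  rw [Set.mem_ofPred_eq, Set.preimage_comp, Function.comp_apply, ← Set.image_singleton,
    Set.preimage_image_eq _ e.injective]
  exact hx
end

section
/- Let n ≥ 2 and let M be a nonempty connected topological n-manifold without boundary (a Hausdorff, second-countable space locally homeomorphic to Euclidean n-space). Then there exists a continuous map f : M → ℝ² such that the set of single points of f is dense in M. -/
open Set Filter Topology Module

/-- A continuous map with one-dimensional image can be perturbed, at an arbitrarily small cost, so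
that a given point `d` becomes a single point, without changing the values at finitely many single
points and without moving any other point much closer to those values. -/
theorem exists_perturbation_single_point {X E : Type*} [MetricSpace X] [NormedAddCommGroup E]
    [InnerProductSpace ℝ E] [FiniteDimensional ℝ E] (hE : 1 < finrank ℝ E)
    {f : X → E} (hf : Continuous f) (hdim : dimH (range f) ≤ 1) {S : Set X} (hS : S.Finite)
    (hsingle : ∀ s ∈ S, ∀ x, f x = f s → x = s) (d : X) {δ : ℝ} (hδ : 0 < δ) :
    ∃ g : X → E, Continuous g ∧ dimH (range g) ≤ 1 ∧ (∀ x, g x = g d → x = d) ∧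
      (∀ s ∈ S, g s = f s) ∧ (∀ x, dist (f x) (g x) ≤ δ) ∧
      ∀ s ∈ S, ∀ x, (1 - δ) * dist (f x) (f s) ≤ dist (g x) (f s) := by
  by_cases hd : d ∈ S
  · refine ⟨f, hf, hdim, hsingle d hd, fun _ _ => rfl, fun x => by simp [hδ.le], fun s _ x => ?_⟩
    nlinarith [dist_nonneg (x := f x) (y := f s)]
  obtain ⟨R, hR, hRδ, hRS⟩ : ∃ R : ℝ, 0 < R ∧ 2 * R < δ ∧
      ∀ s ∈ S, 2 * R < δ * (dist (f d) (f s) - R) := by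
    have h1 : ∀ᶠ R : ℝ in 𝓝 0, 2 * R < δ := by
      have : ContinuousAt (fun R : ℝ => 2 * R) 0 := by fun_prop
      exact this.eventually_lt continuousAt_const (by simpa using hδ)
    have h2 : ∀ᶠ R : ℝ in 𝓝 0, ∀ s ∈ S, 2 * R < δ * (dist (f d) (f s) - R) := by
      refine (eventually_all_finite hS).2 fun s hs => ?_
      have hne : f d ≠ f s := fun h => hd (hsingle s hs d h ▸ hs)
      have hl : ContinuousAt (fun R : ℝ => 2 * R) 0 := by fun_prop
      have hr : ContinuousAt (fun R : ℝ => δ * (dist (f d) (f s) - R)) 0 := by fun_prop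
      exact hl.eventually_lt hr (by simpa using mul_pos hδ (dist_pos.2 hne))
    obtain ⟨R, ⟨hR1, hR2⟩, hR⟩ := (((h1.and h2).filter_mono nhdsWithin_le_nhds).and
      (self_mem_nhdsWithin : Ioi (0 : ℝ) ∈ 𝓝[>] 0)).exists
    exact ⟨R, hR, hR1, hR2⟩
  set p := f d with hp
  let b : ContDiffBump p := ⟨R / 2, R, by positivity, by linarith⟩
  let ρ : E → E := fun y => y - b y • (y - p)
  have hρ : ContDiff ℝ 1 ρ := contDiff_id.sub (b.contDiff.smul (contDiff_id.sub contDiff_const))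
  have hρ_out : ∀ y, R ≤ dist y p → ρ y = y := fun y hy => by
    simp [ρ, b.zero_of_le_dist hy]
  have hρ_in : ∀ y, dist y p ≤ R / 2 → ρ y = p := fun y hy => by
    simp [ρ, b.one_of_mem_closedBall (x := y) hy]
  have hρ_dist : ∀ y, dist (ρ y) p ≤ dist y p := fun y => by
    have : ρ y - p = (1 - b y) • (y - p) := by simp only [ρ]; module
    rw [dist_eq_norm, this, norm_smul, dist_eq_norm, Real.norm_eq_abs]
    refine mul_le_of_le_one_left (norm_nonneg _) (abs_le.2 ⟨?_, ?_⟩) <;>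
      linarith [b.nonneg (x := y), b.le_one (x := y)]
  have hdim' : dimH (ρ '' range f) ≤ 1 :=
    (hρ.contDiffOn.dimH_image_le convex_univ (subset_univ _)).trans hdim
  obtain ⟨q, hqR, hq⟩ : ∃ q ∈ Metric.ball p R, q ∉ ρ '' range f := by
    have hdense : Dense (ρ '' range f)ᶜ :=
      dense_compl_of_dimH_lt_finrank (hdim'.trans_lt (by exact_mod_cast hE))
    obtain ⟨q, hq1, hq2⟩ := hdense.exists_mem_open Metric.isOpen_ball
      (Metric.nonempty_ball.2 hR : (Metric.ball p R).Nonempty)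
    exact ⟨q, hq2, hq1⟩
  have hqp : q ≠ p := by
    rintro rfl
    exact hq ⟨f d, mem_range_self d, hρ_in _ (by rw [← hp, dist_self]; positivity)⟩
  obtain ⟨r, hr, hrf⟩ := Metric.continuous_iff.1 hf d (R / 2) (by positivity)
  let ψ : X → ℝ := fun x => max 0 (1 - dist x d / r)
  have hψ_le : ∀ x, ψ x ≤ 1 := fun x =>
    max_le zero_le_one (by linarith [div_nonneg (dist_nonneg (x := x) (y := d)) hr.le])
  have hψ0 : ∀ x, 0 ≤ ψ x := fun x => le_max_left _ _
  have hψd : ψ d = 1 := by simp [ψ]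
  have hψ_one : ∀ x, ψ x = 1 → x = d := fun x hx => by
    have h1 : 1 - dist x d / r = 1 := by
      rcases max_choice 0 (1 - dist x d / r) with h | h
      · exact absurd (h.symm.trans hx) zero_ne_one
      · exact h.symm.trans hx
    have h2 : dist x d / r = 0 := by linarith
    exact dist_eq_zero.1 ((div_eq_zero_iff.1 h2).resolve_right hr.ne')
  have hψ_supp : ∀ x, ψ x ≠ 0 → dist (f x) p < R / 2 := fun x hx => by
    refine hrf x ?_
    by_contra! h
    exact hx (max_eq_left (by linarith [(one_le_div hr).2 h]))
  have hψc : Continuous ψ := by fun_prop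
  let g : X → E := fun x => ρ (f x) + ψ x • (q - p)
  have hg0 : ∀ x, ψ x = 0 → g x = ρ (f x) := fun x hx => by simp [g, hx]
  have hg1 : ∀ x, ψ x ≠ 0 → g x = p + ψ x • (q - p) := fun x hx => by
    simp only [g, hρ_in _ (hψ_supp x hx).le]
  have hgd : g d = q := by
    rw [hg1 d (by simp [hψd]), hψd]; simp
  have hg_out : ∀ x, R ≤ dist (f x) p → g x = f x := fun x hx => by
    have : ψ x = 0 := by
      by_contra h
      linarith [hψ_supp x h]
    rw [hg0 x this, hρ_out _ hx]
  have hg_in : ∀ x, dist (f x) p < R → dist (g x) p < R := fun x hx => by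
    by_cases h : ψ x = 0
    · rw [hg0 x h]
      exact (hρ_dist _).trans_lt hx
    · rw [hg1 x h, dist_self_add_left, norm_smul, Real.norm_of_nonneg (hψ0 x), ← dist_eq_norm]
      exact (mul_le_of_le_one_left dist_nonneg (hψ_le x)).trans_lt hqR
  have hg_dist : ∀ x, dist (f x) p < R → dist (f x) (g x) < 2 * R := fun x hx => by
    linarith [dist_triangle_right (f x) (g x) p, hg_in x hx]
  refine ⟨g, (hρ.continuous.comp hf).add (hψc.smul continuous_const), ?_, ?_, ?_, ?_, ?_⟩
  · have hsub : range g ⊆ ρ '' range f ∪ range (fun t : ℝ => p + t • (q - p)) := by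
      rintro _ ⟨x, rfl⟩
      by_cases h : ψ x = 0
      · exact Or.inl ⟨f x, mem_range_self x, (hg0 x h).symm⟩
      · exact Or.inr ⟨ψ x, (hg1 x h).symm⟩
    have hline : ContDiff ℝ 1 (fun t : ℝ => p + t • (q - p)) := by fun_prop
    refine (dimH_mono hsub).trans ?_
    rw [dimH_union]
    exact max_le hdim' (by simpa using hline.dimH_range_le)
  · intro x hx
    rw [hgd] at hx
    by_cases h : ψ x = 0
    · exact absurd ⟨f x, mem_range_self x, (hg0 x h).symm.trans hx⟩ hq
    · rw [hg1 x h] at hx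
      have h0 : (ψ x - 1) • (q - p) = 0 := by
        rw [← sub_eq_zero.2 hx]; module
      exact hψ_one x (by linarith [(smul_eq_zero.1 h0).resolve_right (sub_ne_zero.2 hqp)])
  · intro s hs
    refine hg_out s ?_
    have := hRS s hs
    rw [dist_comm]
    by_contra! h
    nlinarith
  · intro x
    by_cases h : dist (f x) p < R
    · linarith [hg_dist x h]
    · rw [hg_out x (not_lt.1 h), dist_self]
      exact hδ.le
  · intro s hs x
    by_cases h : dist (f x) p < R
    · have h1 := hRS s hs
      have h2 := dist_triangle_left p (f s) (f x)
      have h3 := dist_triangle (f x) (g x) (f s)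
      have h4 := hg_dist x h
      nlinarith
    · rw [hg_out x (not_lt.1 h)]
      nlinarith [dist_nonneg (x := f x) (y := f s)]

/-- Every separable metric space admits a continuous map with a dense set of single points to any
Euclidean space of dimension at least two. -/
theorem exists_continuous_dense_single_points {X E : Type*} [MetricSpace X]
    [TopologicalSpace.SeparableSpace X] [NormedAddCommGroup E] [InnerProductSpace ℝ E]
    [FiniteDimensional ℝ E] (hE : 1 < finrank ℝ E) :
    ∃ f : X → E, Continuous f ∧ Dense {x : X | f ⁻¹' {f x} = {x}} := by
  rcases isEmpty_or_nonempty X with hX | hX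
  · exact ⟨fun _ => 0, continuous_const, fun x => isEmptyElim x⟩
  let d := TopologicalSpace.denseSeq X
  let P : ℕ → (X → E) → Prop := fun k f => Continuous f ∧ dimH (range f) ≤ 1 ∧
    ∀ i < k, ∀ x, f x = f (d i) → x = d i
  let Q : ℕ → (X → E) → (X → E) → Prop := fun k f g =>
    (∀ i < k, g (d i) = f (d i)) ∧ (∀ x, dist (f x) (g x) ≤ 1 / 2 / 2 / 2 ^ k) ∧
      ∀ i < k, ∀ x, (1 - 1 / 2 / 2 / 2 ^ k) * dist (f x) (f (d i)) ≤ dist (g x) (f (d i))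
  have hstep : ∀ k f, P k f → ∃ g, P (k + 1) g ∧ Q k f g := by
    rintro k f ⟨hf, hdim, hs⟩
    obtain ⟨g, hg, hgdim, hgd, hgS, hfg, hgs⟩ := exists_perturbation_single_point hE hf hdim
      (S := d '' Iio k) ((finite_Iio k).image d) (by rintro _ ⟨i, hi, rfl⟩; exact hs i hi) (d k)
      (δ := 1 / 2 / 2 / 2 ^ k) (by positivity)
    have hlt : (1 / 2 / 2 / 2 ^ k : ℝ) < 1 := by
      rw [div_lt_one (by positivity)]
      linarith [one_le_pow₀ (one_le_two : (1 : ℝ) ≤ 2) (n := k)]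
    refine ⟨g, ⟨hg, hgdim, fun i hi x hx => ?_⟩, fun i hi => hgS _ ⟨i, hi, rfl⟩, hfg,
      fun i hi => hgs _ ⟨i, hi, rfl⟩⟩
    rcases Nat.lt_succ_iff_lt_or_eq.1 hi with hi | rfl
    · have h1 := hgs _ ⟨i, hi, rfl⟩ x
      rw [hx, hgS _ ⟨i, hi, rfl⟩, dist_self] at h1
      refine hs i hi x (dist_le_zero.1 ?_)
      by_contra! h
      nlinarith
    · exact hgd x hx
  choose! next hnext using hstep
  let F : ℕ → X → E := fun k => Nat.rec (fun _ => 0) next k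
  have hP : ∀ k, P k (F k) := fun k => by
    induction k with
    | zero =>
      refine ⟨continuous_const, ?_, by simp⟩
      change dimH (range fun _ : X => (0 : E)) ≤ 1
      simp
    | succ k ih => exact (hnext k _ ih).1
  have hQ : ∀ k, Q k (F k) (F (k + 1)) := fun k => (hnext k _ (hP k)).2
  have hcauchy : ∀ x, CauchySeq fun k => F k x := fun x =>
    cauchySeq_of_le_geometric_two (C := 1 / 2) fun k => (hQ k).2.1 x
  choose f hf using fun x => cauchySeq_tendsto_of_complete (hcauchy x)
  have hunif : TendstoUniformly F f atTop := by
    rw [Metric.tendstoUniformly_iff]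
    intro ε hε
    have hlim : Tendsto (fun k : ℕ => (1 / 2 / 2 ^ k : ℝ)) atTop (𝓝 0) := by
      simpa [div_eq_mul_inv] using (tendsto_pow_atTop_nhds_zero_of_lt_one (r := (2 : ℝ)⁻¹)
        (by norm_num) (by norm_num)).const_mul (2 : ℝ)⁻¹
    filter_upwards [hlim.eventually_lt_const hε] with k hk x
    rw [dist_comm]
    exact (dist_le_of_le_geometric_two_of_tendsto (C := 1 / 2)
      (fun k => (hQ k).2.1 x) (hf x) k).trans_lt hk
  have hfix : ∀ i k, i < k → F k (d i) = F (i + 1) (d i) := fun i k hk => by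
    induction k, hk using Nat.le_induction with
    | base => rfl
    | succ k hk ih => rw [(hQ k).1 i hk, ih]
  have hfd : ∀ i, f (d i) = F (i + 1) (d i) := fun i =>
    tendsto_nhds_unique (hf (d i)) (tendsto_const_nhds.congr' (by
      filter_upwards [eventually_gt_atTop i] with k hk using (hfix i k hk).symm))
  have hlower : ∀ i x k, i < k →
      (1 / 2 + 1 / 2 / 2 ^ k) * dist (F (i + 1) x) (f (d i)) ≤ dist (F k x) (f (d i)) := by
    intro i x k hk
    induction k, hk using Nat.le_induction with
    | base =>
      refine mul_le_of_le_one_left dist_nonneg ?_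
      have : (1 / 2 / 2 ^ i.succ : ℝ) ≤ 1 / 2 :=
        div_le_self (by norm_num) (one_le_pow₀ one_le_two)
      linarith
    | succ k hk ih =>
      have h := (hQ k).2.2 i hk x
      rw [hfix i k hk, ← hfd i] at h
      refine le_trans ?_ h
      set t : ℝ := 1 / 2 / 2 / 2 ^ k with ht
      have h1 : (1 / 2 / 2 ^ k : ℝ) = 2 * t := by rw [ht]; ring
      have h2 : (1 / 2 / 2 ^ (k + 1) : ℝ) = t := by rw [ht, pow_succ]; field_simp
      have ht0 : 0 < t := by positivity
      have ht1 : t ≤ 1 / 4 := by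
        rw [ht]
        exact (div_le_self (by norm_num) (one_le_pow₀ one_le_two)).trans (by norm_num)
      rw [h1] at ih
      rw [h2]
      calc (1 / 2 + t) * dist (F (i + 1) x) (f (d i))
          ≤ (1 - t) * (1 / 2 + 2 * t) * dist (F (i + 1) x) (f (d i)) :=
            mul_le_mul_of_nonneg_right (by nlinarith) dist_nonneg
        _ ≤ (1 - t) * dist (F k x) (f (d i)) := by
            rw [mul_assoc]
            exact mul_le_mul_of_nonneg_left ih (by linarith)
  refine ⟨f, hunif.continuous (Frequently.of_forall fun k => (hP k).1),
    (TopologicalSpace.denseRange_denseSeq X).mono ?_⟩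
  rintro _ ⟨i, rfl⟩
  refine Subset.antisymm (fun x hx => ?_) (by simp)
  have hx : f x = f (d i) := hx
  have hle : 1 / 2 * dist (F (i + 1) x) (f (d i)) ≤ dist (f x) (f (d i)) := by
    refine ge_of_tendsto ((hf x).dist tendsto_const_nhds) ?_
    filter_upwards [eventually_gt_atTop i] with k hk
    refine le_trans (mul_le_mul_of_nonneg_right ?_ dist_nonneg) (hlower i x k hk)
    exact le_add_of_nonneg_right (by positivity)
  rw [hx, dist_self] at hle
  have h0 : F (i + 1) x = f (d i) := dist_le_zero.1 (by linarith)
  exact (hP (i + 1)).2.2 i i.lt_succ_self x (h0.trans (hfd i))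

/-- Let `n ≥ 2` and let `M` be a nonempty connected topological `n`-manifold
without boundary (Hausdorff, second countable, locally homeomorphic to `ℝⁿ`, here encoded by a
charted space structure over `EuclideanSpace ℝ (Fin n)`). Then there is a continuous map
`f : M → ℝ²` whose set of single points is dense in `M`. -/
theorem exists_map_manifold_to_plane_dense_single_points (n : ℕ) (hn : 2 ≤ n)
    (M : Type*) [TopologicalSpace M] [T2Space M] [SecondCountableTopology M]
    [ChartedSpace (EuclideanSpace ℝ (Fin n)) M] [ConnectedSpace M] [Nonempty M] :
    ∃ f : M → EuclideanSpace ℝ (Fin 2),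
      Continuous f ∧ Dense {x : M | f ⁻¹' {f x} = {x}} := by
  have : LocallyCompactSpace M := ChartedSpace.locallyCompactSpace (EuclideanSpace ℝ (Fin n)) M
  let : MetricSpace M := TopologicalSpace.metrizableSpaceMetric M
  exact exists_continuous_dense_single_points (by simp)
end

section
/- There is no continuous map f : D² → ℝ from the closed unit disc of the plane into the real line for which the set of single points of f is dense in D²; that is, for every continuous f : D² → ℝ, the set {x ∈ D² : f⁻¹(f(x)) = {x}} is not dense in D². -/
open Metric Set

/-- If a single point `x` takes a value strictly between those at `p` and `q`, it lies on the
segment joining them. -/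
theorem mem_segment_of_preimage_eq_singleton {E : Type*} [AddCommGroup E] [Module ℝ E]
    [TopologicalSpace E] [ContinuousAdd E] [ContinuousSMul ℝ E] {s : Set E} (hs : Convex ℝ s)
    {f : s → ℝ} (hf : Continuous f) {p q x : s} (hx : f ⁻¹' {f x} = {x})
    (hp : f p < f x) (hq : f x < f q) : (x : E) ∈ segment ℝ (p : E) q := by
  have hpre : IsPreconnected ((↑) ⁻¹' segment ℝ (p : E) q : Set s) := by
    rw [← Topology.IsInducing.subtypeVal.isPreconnected_image, Subtype.image_preimage_coe,
      inter_eq_right.2 (hs.segment_subset p.2 q.2)]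
    exact (convex_segment _ _).isPreconnected
  obtain ⟨z, hz, hzx⟩ := hpre.intermediate_value (left_mem_segment ℝ (p : E) q)
    (right_mem_segment ℝ (p : E) q) hf.continuousOn ⟨hp.le, hq.le⟩
  have : z ∈ f ⁻¹' {f x} := hzx
  rw [hx, mem_singleton_iff] at this
  exact this ▸ hz

theorem cross_eq_zero_of_mem_segment {u v w : EuclideanSpace ℝ (Fin 2)}
    (h : w ∈ segment ℝ u v) : (u 0 - w 0) * (v 1 - w 1) = (u 1 - w 1) * (v 0 - w 0) := by
  obtain ⟨r, t, -, -, hrt, rfl⟩ := h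
  obtain rfl : r = 1 - t := by linarith
  simp only [PiLp.add_apply, PiLp.smul_apply, smul_eq_mul]
  ring

/-- Over the closed disc, a single point is a global maximum or a global minimum. -/
theorem isMax_or_isMin_of_preimage_eq_singleton
    {f : closedBall (0 : EuclideanSpace ℝ (Fin 2)) 1 → ℝ} (hf : Continuous f)
    {x : closedBall (0 : EuclideanSpace ℝ (Fin 2)) 1} (hx : f ⁻¹' {f x} = {x}) :
    (∀ y, f y ≤ f x) ∨ ∀ y, f x ≤ f y := by
  by_contra! ⟨⟨b, hb⟩, a, ha⟩
  have hconv := convex_closedBall (0 : EuclideanSpace ℝ (Fin 2)) 1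
  have hab := cross_eq_zero_of_mem_segment
    (mem_segment_of_preimage_eq_singleton hconv hf hx ha hb)
  have key : ∀ c : closedBall (0 : EuclideanSpace ℝ (Fin 2)) 1,
      (c.1 0 - x.1 0) * (b.1 1 - x.1 1) = (c.1 1 - x.1 1) * (b.1 0 - x.1 0) ∨
      (a.1 0 - x.1 0) * (c.1 1 - x.1 1) = (a.1 1 - x.1 1) * (c.1 0 - x.1 0) := by
    intro c
    rcases lt_trichotomy (f c) (f x) with h | h | h
    · exact .inl (cross_eq_zero_of_mem_segment
        (mem_segment_of_preimage_eq_singleton hconv hf hx h hb))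
    · have hc : c ∈ f ⁻¹' {f x} := h
      rw [hx, mem_singleton_iff] at hc
      simp [hc]
    · exact .inr (cross_eq_zero_of_mem_segment
        (mem_segment_of_preimage_eq_singleton hconv hf hx ha h))
  have ne_of : ∀ y : closedBall (0 : EuclideanSpace ℝ (Fin 2)) 1, f y ≠ f x →
      y.1 0 - x.1 0 ≠ 0 ∨ y.1 1 - x.1 1 ≠ 0 := by
    intro y hy
    by_contra! h
    refine hy (congrArg f (Subtype.ext ?_))
    ext i
    fin_cases i
    · exact sub_eq_zero.1 h.1
    · exact sub_eq_zero.1 h.2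
  have ha' := ne_of a ha.ne
  have hb' := ne_of b hb.ne'
  have line : ∀ c : closedBall (0 : EuclideanSpace ℝ (Fin 2)) 1,
      (c.1 0 - x.1 0) * (b.1 1 - x.1 1) = (c.1 1 - x.1 1) * (b.1 0 - x.1 0) := by
    intro c
    refine (key c).elim id fun h => ?_
    rcases ha' with h0 | h0
    · apply mul_left_cancel₀ h0
      linear_combination (c.1 0 - x.1 0) * hab - (b.1 0 - x.1 0) * h
    · apply mul_left_cancel₀ h0
      linear_combination (c.1 1 - x.1 1) * hab - (b.1 1 - x.1 1) * h
  have h0 := line ⟨0, by simp⟩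
  have h1 := line ⟨EuclideanSpace.single 0 1, by simp⟩
  have h2 := line ⟨EuclideanSpace.single 1 1, by simp⟩
  simp at h0 h1 h2
  rcases hb' with h | h
  · apply h; linarith
  · apply h; linarith

/-- There is no continuous map `f : D² → ℝ` whose set of single points is
dense in `D²`. -/
theorem not_dense_single_points_disc_two_to_real
    (f : (Metric.closedBall (0 : EuclideanSpace ℝ (Fin 2)) 1) → ℝ) (hf : Continuous f) :
    ¬ Dense {x : Metric.closedBall (0 : EuclideanSpace ℝ (Fin 2)) 1 | f ⁻¹' {f x} = {x}} := by
  intro hd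
  set S := {x : closedBall (0 : EuclideanSpace ℝ (Fin 2)) 1 | f ⁻¹' {f x} = {x}}
  have inj : ∀ x ∈ S, ∀ y, f y = f x → y = x := fun x hx y hy => by
    have : y ∈ f ⁻¹' {f x} := hy
    rwa [show f ⁻¹' {f x} = {x} from hx] at this
  have hmax : (S ∩ {x | ∀ y, f y ≤ f x}).Subsingleton := fun x hx y hy =>
    inj y hy.1 x (le_antisymm (hy.2 x) (hx.2 y))
  have hmin : (S ∩ {x | ∀ y, f x ≤ f y}).Subsingleton := fun x hx y hy =>
    inj y hy.1 x (le_antisymm (hx.2 y) (hy.2 x))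
  have hfin : S.Finite := (hmax.finite.union hmin.finite).subset fun x hx =>
    (isMax_or_isMin_of_preimage_eq_singleton hf hx).imp (⟨hx, ·⟩) (⟨hx, ·⟩)
  have huniv : S = univ := hfin.isClosed.closure_eq.symm.trans hd.closure_eq
  have hinf : (closedBall (0 : EuclideanSpace ℝ (Fin 2)) 1).Infinite :=
    (convex_closedBall _ _).isPreconnected.infinite_of_nontrivial
      ⟨0, by simp, EuclideanSpace.single 0 1, by simp, fun h => by
        simpa using congrArg (· 0) h⟩
  have := hinf.to_subtype
  exact infinite_univ (huniv ▸ hfin)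
end

section
/- For every integer n ≥ 2, there is no continuous map f : D^n → ℝ from the closed unit ball of Euclidean n-space into the real line for which the set of single points of f is dense in D^n; that is, for every continuous f : D^n → ℝ, the set {x ∈ D^n : f⁻¹(f(x)) = {x}} is not dense in D^n. -/
/-- If `f b` lies strictly between `f a` and `f c`, for `f` continuous and real-valued on a space
where the complement of `b` is preconnected, then `b` is not the only point of its fiber. -/
theorem preimage_singleton_ne_singleton_of_lt_of_lt {X : Type*} [TopologicalSpace X] {f : X → ℝ}
    (hf : Continuous f) {a b c : X} (hb : IsPreconnected ({b}ᶜ : Set X))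
    (hab : f a < f b) (hbc : f b < f c) : f ⁻¹' {f b} ≠ {b} := by
  intro h
  have ha : a ∈ ({b}ᶜ : Set X) := fun e => hab.ne (congrArg f e)
  have hc : c ∈ ({b}ᶜ : Set X) := fun e => hbc.ne' (congrArg f e)
  obtain ⟨y, hy, hyb⟩ := hb.intermediate_value ha hc hf.continuousOn ⟨hab.le, hbc.le⟩
  exact hy (h.subset hyb)

/-- If the complement of every point of `X` is preconnected, then a continuous map `X → ℝ` has
only finitely many single points. -/
theorem finite_setOf_preimage_singleton_eq {X : Type*} [TopologicalSpace X]
    (hX : ∀ x : X, IsPreconnected ({x}ᶜ : Set X)) {f : X → ℝ} (hf : Continuous f) :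
    {x | f ⁻¹' {f x} = {x}}.Finite := by
  by_contra hinf
  obtain ⟨t, hts, ht⟩ := Set.Infinite.exists_subset_card_eq hinf 3
  obtain ⟨a, ha, b, hb, c, hc, hab, hac, hbc⟩ := Finset.two_lt_card.1 (by omega : 2 < t.card)
  have key : ∀ x ∈ t, ∀ y ∈ t, ∀ z ∈ t, f x < f y → ¬ f y < f z := fun x _ y hy z _ hxy hyz =>
    preimage_singleton_ne_singleton_of_lt_of_lt hf (hX y) hxy hyz (hts hy)
  have inj : ∀ x ∈ t, ∀ y, x ≠ y → f x ≠ f y := fun x hx y hxy h =>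
    hxy ((hts hx : f ⁻¹' {f x} = {x}).subset h.symm).symm
  have := inj a ha b hab
  have := inj a ha c hac
  have := inj b hb c hbc
  grind

/-- For every `n ≥ 2`, there is no continuous map `f : D^n → ℝ` whose set of
single points is dense in `D^n`. -/
theorem not_dense_single_points_disc_to_real (n : ℕ) (hn : 2 ≤ n)
    (f : (Metric.closedBall (0 : EuclideanSpace ℝ (Fin n)) 1) → ℝ) (hf : Continuous f) :
    ¬ Dense {x : Metric.closedBall (0 : EuclideanSpace ℝ (Fin n)) 1 | f ⁻¹' {f x} = {x}} := by
  intro hd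
  have hrank : 1 < Module.rank ℝ (EuclideanSpace ℝ (Fin n)) := by
    rw [← Module.finrank_eq_rank, finrank_euclideanSpace_fin]
    exact_mod_cast hn
  have : Nontrivial (EuclideanSpace ℝ (Fin n)) :=
    (rank_pos_iff_nontrivial (R := ℝ)).1 (zero_lt_one.trans hrank)
  have : Infinite (EuclideanSpace ℝ (Fin n)) := Module.Free.infinite ℝ _
  have hsub := Metric.ball_subset_closedBall (x := (0 : EuclideanSpace ℝ (Fin n))) (ε := 1)
  let g := Set.inclusion hsub ∘ (Homeomorph.unitBall (E := EuclideanSpace ℝ (Fin n)))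
  have hg : Topology.IsOpenEmbedding g :=
    (Topology.IsOpenEmbedding.inclusion hsub
      (Metric.isOpen_ball.preimage continuous_subtype_val)).comp Homeomorph.unitBall.isOpenEmbedding
  have hfin := finite_setOf_preimage_singleton_eq
    (fun x => (isConnected_compl_singleton_of_one_lt_rank hrank x).isPreconnected)
    (hf.comp hg.continuous)
  have hdense : Dense {x | (f ∘ g) ⁻¹' {(f ∘ g) x} = {x}} := by
    refine (hd.preimage hg.isOpenMap).mono fun x hx => ?_
    change f ⁻¹' {f (g x)} = {g x} at hx
    change g ⁻¹' (f ⁻¹' {f (g x)}) = {x}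
    rw [hx, ← Set.image_singleton, hg.injective.preimage_image]
  refine Set.infinite_univ (α := EuclideanSpace ℝ (Fin n)) ?_
  rwa [← hdense.closure_eq, hfin.isClosed.closure_eq]
end

section
/- Let Y ⊂ ℝ² be the union of the three segments {(t,0) : t ∈ [0,1]}, {(0,t) : t ∈ [0,1]} and {(-t,0) : t ∈ [0,1]} (three segments meeting at the origin, the letter 'Y'-shaped graph). Then for every continuous map f : Y → ℝ, the set of single points of f is not dense in Y. -/
open Set unitInterval in
/-- If a real function rises above its value at the common starting point of two paths, and the
first path runs, after its start, in an open set avoided by the second, then the single points of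
the function are not dense. -/
theorem not_dense_single_points_of_two_paths {X : Type*} [TopologicalSpace X] {f : X → ℝ}
    (hf : Continuous f) {o : X} {a b : I → X} (ha : Continuous a) (hb : Continuous b)
    (ha0 : a 0 = o) (hb0 : b 0 = o) {U : Set X} (hU : IsOpen U)
    (haU : ∀ t, t ≠ 0 → a t ∈ U) (hbU : ∀ t, b t ∉ U)
    (hfa : ∃ s, f o < f (a s)) (hfb : ∃ s, f o < f (b s)) :
    ¬ Dense {x : X | f ⁻¹' {f x} = {x}} := by
  intro hD
  obtain ⟨s, hs⟩ := hfa
  obtain ⟨t, ht⟩ := hfb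
  obtain ⟨v, hv, hvm⟩ := exists_between (lt_min hs ht)
  obtain ⟨r, hr⟩ : v ∈ range (f ∘ a) :=
    mem_range_of_exists_le_of_exists_ge (hf.comp ha) ⟨0, by simpa [ha0] using hv.le⟩
      ⟨s, (hvm.trans_le (min_le_left _ _)).le⟩
  have hr0 : r ≠ 0 := by
    rintro rfl
    simp only [Function.comp_apply, ha0] at hr
    exact hv.ne hr
  obtain ⟨p, ⟨hpU, hpo, hpm⟩, hp⟩ := hD.inter_open_nonempty
    (U ∩ f ⁻¹' Ioo (f o) (min (f (a s)) (f (b t))))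
    (hU.inter (isOpen_Ioo.preimage hf))
    ⟨a r, haU r hr0, by simpa [← hr] using hv, by simpa [← hr] using hvm⟩
  obtain ⟨q, hq⟩ : f p ∈ range (f ∘ b) :=
    mem_range_of_exists_le_of_exists_ge (hf.comp hb) ⟨0, by simpa [hb0] using hpo.le⟩
      ⟨t, (hpm.trans_le (min_le_right _ _)).le⟩
  have hqp : b q ∈ f ⁻¹' {f p} := hq
  rw [hp] at hqp
  exact hbU q (hqp ▸ hpU)

open Set unitInterval in
/-- A real function on a space made of three paths that start at the same point and then stay in
disjoint open sets does not have a dense set of single points. -/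
theorem not_dense_single_points_of_three_paths {X : Type*} [TopologicalSpace X] {f : X → ℝ}
    (hf : Continuous f) {o : X} {a : Fin 3 → I → X} (ha : ∀ i, Continuous (a i))
    (ha0 : ∀ i, a i 0 = o) {U : Fin 3 → Set X} (hU : ∀ i, IsOpen (U i))
    (hoU : ∀ i, o ∉ U i) (hdisj : Pairwise (Function.onFun Disjoint U))
    (haU : ∀ i t, t ≠ 0 → a i t ∈ U i) (hUa : ∀ i, U i ⊆ range (a i)) :
    ¬ Dense {x : X | f ⁻¹' {f x} = {x}} := by
  intro hD
  have hne (i : Fin 3) : ∃ t, f (a i t) ≠ f o := by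
    obtain ⟨p, hpU, hp⟩ := hD.inter_open_nonempty (U i) (hU i) ⟨a i 1, haU i 1 one_ne_zero⟩
    obtain ⟨t, rfl⟩ := hUa i hpU
    refine ⟨t, fun h => hoU i ?_⟩
    have ho : o ∈ f ⁻¹' {f (a i t)} := h.symm
    rw [hp] at ho
    exact ho ▸ hpU
  have havoid {i j : Fin 3} (hij : i ≠ j) (t : I) : a j t ∉ U i := by
    by_cases ht : t = 0
    · rw [ht, ha0]
      exact hoU i
    · exact fun h => disjoint_left.1 (hdisj hij) h (haU j t ht)
  have hup (i j : Fin 3) (hij : i ≠ j) (hi : ∃ s, f o < f (a i s)) :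
      ¬ ∃ s, f o < f (a j s) := fun hj =>
    not_dense_single_points_of_two_paths hf (ha i) (ha j) (ha0 i) (ha0 j) (hU i) (haU i)
      (havoid hij) hi hj hD
  have hdown (i j : Fin 3) (hij : i ≠ j) (hi : ∃ s, f (a i s) < f o) :
      ¬ ∃ s, f (a j s) < f o := fun hj =>
    not_dense_single_points_of_two_paths hf.neg (ha i) (ha j) (ha0 i) (ha0 j) (hU i) (haU i)
      (havoid hij) (by simpa using hi) (by simpa using hj) (by
        convert hD using 4
        simp [Set.ext_iff])
  have hside (i : Fin 3) : (∃ s, f (a i s) < f o) ∨ ∃ s, f o < f (a i s) := by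
    obtain ⟨t, ht⟩ := hne i
    exact ht.lt_or_gt.imp (fun h => ⟨t, h⟩) fun h => ⟨t, h⟩
  have h01 : (0 : Fin 3) ≠ 1 := by decide
  have h02 : (0 : Fin 3) ≠ 2 := by decide
  have h12 : (1 : Fin 3) ≠ 2 := by decide
  rcases hside 0 with h0 | h0 <;> rcases hside 1 with h1 | h1
  · exact hdown 0 1 h01 h0 h1
  · exact (hside 2).elim (hdown 0 2 h02 h0) (hup 1 2 h12 h1)
  · exact (hside 2).elim (hdown 1 2 h12 h1) (hup 0 2 h02 h0)
  · exact hup 0 1 h01 h0 h1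


/-- Let `Y ⊆ ℝ²` be the union of the three unit segments from the origin
along the positive `x`-axis, the positive `y`-axis and the negative `x`-axis (the letter
`Y`-shaped graph). Then for every continuous map `f : Y → ℝ`, the set of single points of `f`
is not dense in `Y`. -/
theorem not_dense_single_points_tripod_to_real
    (Y : Set (ℝ × ℝ))
    (hY : Y = ((fun t : ℝ => ((t, 0) : ℝ × ℝ)) '' Set.Icc (0 : ℝ) 1) ∪
        ((fun t : ℝ => ((0, t) : ℝ × ℝ)) '' Set.Icc (0 : ℝ) 1) ∪
        ((fun t : ℝ => ((-t, 0) : ℝ × ℝ)) '' Set.Icc (0 : ℝ) 1))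
    (f : Y → ℝ) (hf : Continuous f) :
    ¬ Dense {x : Y | f ⁻¹' {f x} = {x}} := by
  have hmem (i : Fin 3) (t : unitInterval) :
      (![((t : ℝ), (0 : ℝ)), (0, (t : ℝ)), (-(t : ℝ), 0)] : Fin 3 → ℝ × ℝ) i ∈ Y := by
    subst hY
    fin_cases i
    · exact Or.inl (Or.inl ⟨t, t.2, rfl⟩)
    · exact Or.inl (Or.inr ⟨t, t.2, rfl⟩)
    · exact Or.inr ⟨t, t.2, rfl⟩
  have hpos (t : unitInterval) (ht : t ≠ 0) : (0 : ℝ) < t := unitInterval.pos_iff_ne_zero.2 ht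
  refine not_dense_single_points_of_three_paths hf (o := ⟨(0, 0), by simpa using hmem 0 0⟩)
    (a := fun i t => ⟨_, hmem i t⟩)
    (U := ![{y | 0 < y.1.1}, {y | 0 < y.1.2}, {y | y.1.1 < 0}]) ?_ ?_ ?_ ?_ ?_ ?_ ?_
  · intro i
    refine Continuous.subtype_mk ?_ _
    fin_cases i
    · exact continuous_subtype_val.prodMk continuous_const
    · exact continuous_const.prodMk continuous_subtype_val
    · exact continuous_subtype_val.neg.prodMk continuous_const
  · intro i
    fin_cases i <;> simp
  · intro i
    fin_cases i
    · exact isOpen_lt (by fun_prop) (by fun_prop)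
    · exact isOpen_lt (by fun_prop) (by fun_prop)
    · exact isOpen_lt (by fun_prop) (by fun_prop)
  · intro i
    fin_cases i <;> simp
  · intro i j hij
    refine Set.disjoint_left.2 ?_
    rintro ⟨⟨x, y⟩, hxy⟩
    rw [hY] at hxy
    simp only [Set.mem_union, Set.mem_image, Prod.mk.injEq] at hxy
    fin_cases i <;> fin_cases j <;> simp at hij ⊢ <;> grind
  · intro i t ht
    have := hpos t ht
    fin_cases i <;> simpa using this
  · rintro i ⟨⟨x, y⟩, hxy⟩ hi
    have hxy' := hxy
    rw [hY] at hxy'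
    simp only [Set.mem_union, Set.mem_image, Prod.mk.injEq, Set.mem_Icc] at hxy'
    fin_cases i
    · have : 0 < x := hi
      exact ⟨⟨x, by grind⟩, Subtype.ext (Prod.ext rfl (by simp; grind))⟩
    · have : 0 < y := hi
      exact ⟨⟨y, by grind⟩, Subtype.ext (Prod.ext (by simp; grind) rfl)⟩
    · have : x < 0 := hi
      exact ⟨⟨-x, by grind⟩, Subtype.ext (Prod.ext (by simp) (by simp; grind))⟩
end
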